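/- For v ∈ ℂ let L(v) = Σ_T (det T)^{−(3/2 + 2v)}, where T runs over all reduced matrices in P(ℤ). The series converges absolutely for Re v > 0, and there exists a function H, holomorphic on the half-plane {v ∈ ℂ : Re v > −1/4}, such that L(v) = π/(3v) + H(v) for all v with Re v > 0; in particular L extends meromorphically to Re v > −1/4 with a unique pole at v = 0, which is simple with residue π/3. -/

import Mathlib

/-- A reduced matrix `T = (a, b; b, c) ∈ P(ℤ)`, encoded with `b2 = 2b ∈ ℤ`:
positive definite (`0 < a`, `b2² < 4ac`), weakly reduced (`2|b| ≤ a ≤ c`), and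
`b ≥ 0` whenever `2|b| = a` or `a = c`. -/
structure ReducedMat where
  a : ℤ
  b2 : ℤ
  c : ℤ
  ha : 0 < a
  hdet : b2^2 < 4*a*c
  hred1 : |b2| ≤ a
  hred2 : a ≤ c
  hred3 : (|b2| = a ∨ a = c) → 0 ≤ b2

/-- The determinant `ac - b² = ac - b2²/4`. -/
noncomputable def ReducedMat.det (T : ReducedMat) : ℝ :=
  (T.a : ℝ) * (T.c : ℝ) - (T.b2 : ℝ)^2/4

open Filter Topology

theorem cpow_sub_bound {s : ℂ} (hs : 0 < s.re) {x y : ℝ} (hx : 0 < x) (hxy : x ≤ y) :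
    ‖(y : ℂ) ^ (-s) - (x : ℂ) ^ (-s)‖ ≤ ‖s‖ * x ^ (-s.re - 1) * (y - x) := by
  have hs0 : -s ≠ 0 := by
    intro h
    have := congrArg Complex.re h
    simp at this
    linarith
  refine norm_image_sub_le_of_norm_deriv_le_segment' (f := fun y : ℝ => (y : ℂ) ^ (-s))
    (f' := fun y => -s * (y : ℂ) ^ (-s - 1)) (a := x) (b := y) ?_ ?_ y ⟨hxy, le_rfl⟩
  · intro t ht
    have ht0 : 0 < t := lt_of_lt_of_le hx ht.1
    exact (hasDerivAt_ofReal_cpow_const ht0.ne' hs0).hasDerivWithinAt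
  · intro t ht
    have ht0 : 0 < t := lt_of_lt_of_le hx ht.1
    rw [norm_mul, norm_neg, Complex.norm_cpow_eq_rpow_re_of_pos ht0]
    simp only [Complex.sub_re, Complex.neg_re, Complex.one_re]
    exact mul_le_mul_of_nonneg_left
      (Real.rpow_le_rpow_of_nonpos hx ht.1 (by linarith)) (norm_nonneg _)

/-- antiderivative (up to sign) -/
noncomputable def gg (s : ℂ) (x : ℝ) : ℂ := (x : ℂ) ^ (1 - s) / (s - 1)

theorem gg_deriv {s : ℂ} (hs : s ≠ 1) {x : ℝ} (hx : 0 < x) :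
    HasDerivAt (gg s) (-(x : ℂ) ^ (-s)) x := by
  have h := (hasDerivAt_ofReal_cpow_const' hx.ne' (r := -s) (by
    intro h; apply hs; linear_combination -h)).neg
  have e : gg s = -fun y : ℝ => (y : ℂ) ^ (-s + 1) / (-s + 1) := by
    funext y
    simp only [gg, Pi.neg_apply]
    rw [show -s + 1 = -(s - 1) by ring, div_neg, neg_neg]
    congr 2
    ring
  rw [e]
  exact h

theorem gg_bound {s : ℂ} (hs : 1 < s.re) {x h : ℝ} (hx : 0 < x) (hh : 0 < h) :
    ‖(x : ℂ) ^ (-s) - (gg s x - gg s (x + h)) / h‖ ≤ ‖s‖ * x ^ (-s.re - 1) * h := by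
  have hs1 : s ≠ 1 := by
    rintro rfl
    simp at hs
  have key := norm_image_sub_le_of_norm_deriv_le_segment'
    (f := fun y : ℝ => gg s y + (y : ℂ) * (x : ℂ) ^ (-s))
    (f' := fun y : ℝ => -(y : ℂ) ^ (-s) + 1 * (x : ℂ) ^ (-s)) (a := x) (b := x + h)
    (C := ‖s‖ * x ^ (-s.re - 1) * h) ?_ ?_ (x + h) ⟨by linarith, le_rfl⟩
  · have e : (x : ℂ) ^ (-s) - (gg s x - gg s (x + h)) / h
        = ((gg s (x + h) + ((x + h : ℝ) : ℂ) * (x : ℂ) ^ (-s)) - (gg s x + (x : ℂ) * (x : ℂ) ^ (-s))) / h := by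
      have : (h : ℂ) ≠ 0 := by exact_mod_cast hh.ne'
      field_simp
      push_cast
      ring
    rw [e, norm_div, Complex.norm_real, Real.norm_of_nonneg hh.le, div_le_iff₀ hh]
    simpa using key
  · intro t ht
    have ht0 : 0 < t := lt_of_lt_of_le hx ht.1
    exact ((gg_deriv hs1 ht0).add ((Complex.ofRealCLM.hasDerivAt (x := t)).mul_const _)).hasDerivWithinAt
  · intro t ht
    have ht0 : 0 < t := lt_of_lt_of_le hx ht.1
    rw [one_mul, neg_add_eq_sub, norm_sub_rev]
    refine (cpow_sub_bound (by linarith) hx ht.1).trans ?_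
    gcongr
    linarith [ht.2]

noncomputable def jj (s : ℂ) (u : ℝ) : ℂ := ((1 - u ^ 2 / 4 : ℝ) : ℂ) ^ (1 - s)

noncomputable def II (s : ℂ) : ℂ := ∫ u in (-1 : ℝ)..1, jj s u

theorem w_bound {u : ℝ} (hu : |u| ≤ 1) : 3 / 4 ≤ 1 - u ^ 2 / 4 := by
  have := (sq_le_one_iff_abs_le_one u).2 hu
  linarith

theorem rpow_bound {x r R : ℝ} (hx : 3 / 4 ≤ x) (hr : 0 ≤ r) (hR : r ≤ R) :
    x ^ (-r) ≤ (4 / 3 : ℝ) ^ R := by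
  calc x ^ (-r) ≤ (3 / 4 : ℝ) ^ (-r) := Real.rpow_le_rpow_of_nonpos (by norm_num) hx (by linarith)
    _ = (4 / 3 : ℝ) ^ r := by
      rw [Real.rpow_neg (by norm_num), ← Real.inv_rpow (by norm_num)]; norm_num
    _ ≤ _ := Real.rpow_le_rpow_of_exponent_le (by norm_num) hR

theorem jj_lip {s : ℂ} (hs : 1 < s.re) {u v : ℝ} (hu : |u| ≤ 1) (hv : |v| ≤ 1) :
    ‖jj s u - jj s v‖ ≤ (‖s‖ + 1) * (4 / 3 : ℝ) ^ ‖s‖ * |u - v| := by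
  wlog h : 1 - v ^ 2 / 4 ≤ 1 - u ^ 2 / 4 generalizing u v
  · rw [norm_sub_rev, abs_sub_comm]
    exact this hv hu (by linarith)
  have h1 := cpow_sub_bound (s := s - 1) (by simpa using hs) (by linarith [w_bound hv]) h
  rw [neg_sub] at h1
  refine h1.trans ?_
  have h2 : (1 - u ^ 2 / 4) - (1 - v ^ 2 / 4) ≤ |u - v| := by
    have : (1 - u ^ 2 / 4) - (1 - v ^ 2 / 4) = (v - u) * ((u + v) / 4) := by ring
    rw [this]
    refine (le_abs_self _).trans ?_
    rw [abs_mul, abs_sub_comm]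
    have : |(u + v) / 4| ≤ 1 := by
      rw [abs_le] at *
      constructor <;> linarith [hu.1, hu.2, hv.1, hv.2]
    nlinarith [abs_nonneg (u - v)]
  have h3 : (1 - v ^ 2 / 4) ^ (-(s - 1).re - 1) ≤ (4 / 3 : ℝ) ^ ‖s‖ := by
    have := rpow_bound (w_bound hv) (r := s.re) (by linarith) (Complex.re_le_norm s)
    simpa using this
  have h4 : ‖s - 1‖ ≤ ‖s‖ + 1 := by
    simpa using norm_sub_le s 1
  have h5 : 0 ≤ (1 - u ^ 2 / 4) - (1 - v ^ 2 / 4) := by linarith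
  have h6 : 0 ≤ (1 - v ^ 2 / 4) := by linarith [w_bound hv]
  gcongr

theorem jj_contOn (s : ℂ) : ContinuousOn (jj s) (Set.uIcc (-1) 1) := by
  intro u hu
  rw [Set.uIcc_of_le (by norm_num)] at hu
  have := w_bound (abs_le.2 hu)
  apply ContinuousAt.continuousWithinAt
  unfold jj
  refine ContinuousAt.cpow ?_ continuousAt_const ?_
  · fun_prop
  · rw [Complex.ofReal_mem_slitPlane]; linarith

theorem II_diff : DifferentiableOn ℂ II Set.univ := by
  intro s _
  apply DifferentiableAt.differentiableWithinAt
  have key := intervalIntegral.hasDerivAt_integral_of_dominated_loc_of_deriv_le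
    (μ := MeasureTheory.volume) (a := -1) (b := 1) (F := jj)
    (F' := fun s u => jj s u * Complex.log ((1 - u ^ 2 / 4 : ℝ) : ℂ) * (-1))
    (x₀ := s) (s := Metric.ball s 1)
    (bound := fun _ => (4 / 3 : ℝ) ^ (‖s‖ + 2) * 2) (Metric.ball_mem_nhds _ one_pos) ?_ ?_ ?_ ?_ ?_ ?_
  · exact key.2.differentiableAt
  · exact Eventually.of_forall fun t => (intervalIntegrable_iff.1 (jj_contOn t).intervalIntegrable).aestronglyMeasurable
  · exact (jj_contOn s).intervalIntegrable
  · refine (intervalIntegrable_iff.1 (ContinuousOn.intervalIntegrable ?_)).aestronglyMeasurable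
    refine ((jj_contOn s).mul ?_).mul continuousOn_const
    intro u hu
    rw [Set.uIcc_of_le (by norm_num)] at hu
    have := w_bound (abs_le.2 hu)
    apply ContinuousAt.continuousWithinAt
    apply ContinuousAt.clog
    · fun_prop
    · rw [Complex.ofReal_mem_slitPlane]; linarith
  · refine Eventually.of_forall fun u hu t ht => ?_
    rw [Set.uIoc_of_le (by norm_num)] at hu
    have hw := w_bound (abs_le.2 ⟨hu.1.le, hu.2⟩)
    have hw1 : 1 - u ^ 2 / 4 ≤ 1 := by nlinarith [sq_nonneg u]
    have hw0 : 0 < 1 - u ^ 2 / 4 := by linarith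
    simp only [norm_mul, norm_neg, norm_one, mul_one]
    have ht' : ‖t‖ ≤ ‖s‖ + 1 := by
      have := norm_add_le (t - s) s
      rw [sub_add_cancel] at this
      rw [Metric.mem_ball, dist_eq_norm] at ht
      linarith
    have h1 : ‖jj t u‖ ≤ (4 / 3 : ℝ) ^ (‖s‖ + 2) := by
      unfold jj
      rw [Complex.norm_cpow_eq_rpow_re_of_pos hw0]
      have hre : -‖t‖ ≤ -t.re := neg_le_neg (Complex.re_le_norm t)
      refine (Real.rpow_le_rpow_of_exponent_ge hw0 hw1 (z := -(‖s‖ + 2)) ?_).trans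
        (rpow_bound hw (by positivity) le_rfl)
      simp only [Complex.sub_re, Complex.one_re]
      linarith
    have h2 : ‖Complex.log ((1 - u ^ 2 / 4 : ℝ) : ℂ)‖ ≤ 2 := by
      rw [← Complex.ofReal_log hw0.le, Complex.norm_real, Real.norm_eq_abs,
        abs_of_nonpos (Real.log_nonpos hw0.le hw1)]
      have := Real.one_sub_inv_le_log_of_pos hw0
      have h3 : (1 - u ^ 2 / 4)⁻¹ ≤ (3 / 4 : ℝ)⁻¹ := inv_anti₀ (by norm_num) hw
      norm_num at h3
      linarith
    exact mul_le_mul h1 h2 (norm_nonneg _) (by positivity)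
  · exact intervalIntegrable_const
  · refine Eventually.of_forall fun u hu t ht => ?_
    rw [Set.uIoc_of_le (by norm_num)] at hu
    have hw := w_bound (abs_le.2 ⟨hu.1.le, hu.2⟩)
    have hw0 : ((1 - u ^ 2 / 4 : ℝ) : ℂ) ≠ 0 := by
      exact_mod_cast (by linarith : 1 - u ^ 2 / 4 ≠ 0)
    exact ((hasDerivAt_id t).const_sub 1).const_cpow (Or.inl hw0)

theorem II_val : II (3 / 2) = ((2 * Real.pi / 3 : ℝ) : ℂ) := by
  have e : Set.EqOn (jj (3 / 2)) (fun u : ℝ => ((1 / √(1 - (u / 2) ^ 2) : ℝ) : ℂ)) (Set.uIcc (-1) 1) := by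
    intro u hu
    rw [Set.uIcc_of_le (by norm_num)] at hu
    have hw := w_bound (abs_le.2 hu)
    have e1 : (1 - (3 / 2) : ℂ) = ((-(1 / 2) : ℝ) : ℂ) := by push_cast; norm_num
    simp only [jj]
    rw [e1, ← Complex.ofReal_cpow (by linarith), Real.rpow_neg (by linarith), ← Real.sqrt_eq_rpow,
      one_div, show (u / 2) ^ 2 = u ^ 2 / 4 by ring]
  unfold II
  rw [intervalIntegral.integral_congr e, intervalIntegral.integral_ofReal]
  congr 1
  have hd : ∀ u ∈ Set.uIcc (-1 : ℝ) 1,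
      HasDerivAt (fun u => 2 * Real.arcsin (u / 2)) (1 / √(1 - (u / 2) ^ 2)) u := by
    intro u hu
    rw [Set.uIcc_of_le (by norm_num)] at hu
    have h := ((Real.hasDerivAt_arcsin (x := u / 2) (by linarith [hu.1]) (by linarith [hu.2])).comp u
      ((hasDerivAt_id u).div_const 2)).const_mul 2
    refine h.congr_deriv ?_
    generalize 1 / √(1 - (u / 2) ^ 2) = q
    ring
  rw [intervalIntegral.integral_eq_sub_of_hasDerivAt hd]
  · have h6 : Real.arcsin (1 / 2) = Real.pi / 6 := by
      rw [← Real.sin_pi_div_six, Real.arcsin_sin] <;> linarith [Real.pi_pos]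
    rw [show (-1 : ℝ) / 2 = -(1 / 2) by ring, Real.arcsin_neg, h6]
    ring
  · apply ContinuousOn.intervalIntegrable
    intro u hu
    rw [Set.uIcc_of_le (by norm_num)] at hu
    have hw := w_bound (abs_le.2 hu)
    apply ContinuousAt.continuousWithinAt
    apply ContinuousAt.div continuousAt_const (by fun_prop)
    apply (Real.sqrt_pos.2 _).ne'
    linarith

theorem riemann_bound {s : ℂ} (hs : 1 < s.re) (n : ℕ) :
    ‖(∑ k ∈ Finset.range (2 * (n + 1)), jj s (((k : ℝ) - n) / (n + 1))) / (n + 1) - II s‖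
      ≤ 2 * ((‖s‖ + 1) * (4 / 3 : ℝ) ^ ‖s‖) / (n + 1) := by
  set C := (‖s‖ + 1) * (4 / 3 : ℝ) ^ ‖s‖ with hC
  have hC0 : 0 ≤ C := by positivity
  have ha : (0 : ℝ) < n + 1 := by positivity
  set p : ℕ → ℝ := fun k => (k : ℝ) / (n + 1) - 1 with hp
  have hp0 : p 0 = -1 := by simp [hp]
  have hp1 : p (2 * (n + 1)) = 1 := by
    simp only [hp]; push_cast; field_simp; norm_num
  have hmono : Monotone p := by
    intro i j hij
    simp only [hp]
    gcongr
  have hin : ∀ k ≤ 2 * (n + 1), p k ∈ Set.Icc (-1 : ℝ) 1 := fun k hk =>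
    ⟨hp0 ▸ hmono (Nat.zero_le k), hp1 ▸ hmono hk⟩
  have hsub : ∀ k < 2 * (n + 1), Set.uIcc (p k) (p (k + 1)) ⊆ Set.uIcc (-1) 1 := by
    intro k hk
    rw [Set.uIcc_of_le (hmono (Nat.le_succ k)), Set.uIcc_of_le (by norm_num)]
    exact Set.Icc_subset_Icc (hin k hk.le).1 (hin (k + 1) hk).2
  have hint : ∀ k < 2 * (n + 1),
      IntervalIntegrable (jj s) MeasureTheory.volume (p k) (p (k + 1)) := fun k hk =>
    ((jj_contOn s).mono (hsub k hk)).intervalIntegrable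
  have hI : II s = ∑ k ∈ Finset.range (2 * (n + 1)), ∫ u in p k..p (k + 1), jj s u := by
    rw [intervalIntegral.sum_integral_adjacent_intervals hint, hp0, hp1, II]
  have hlen : ∀ k, p (k + 1) - p k = 1 / (n + 1) := by
    intro k; simp only [hp]; push_cast; field_simp; ring
  rw [hI, Finset.sum_div, ← Finset.sum_sub_distrib]
  refine (norm_sum_le _ _).trans ?_
  have hterm : ∀ k ∈ Finset.range (2 * (n + 1)),
      ‖jj s (((k : ℝ) - n) / (n + 1)) / (n + 1) - ∫ u in p k..p (k + 1), jj s u‖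
        ≤ C * (1 / (n + 1)) * (1 / (n + 1)) := by
    intro k hk
    have hk := Finset.mem_range.1 hk
    have e1 : ((k : ℝ) - n) / (n + 1) = p (k + 1) := by
      simp only [hp]; push_cast; field_simp; ring
    have e2 : jj s (p (k + 1)) / (n + 1) = ∫ u in p k..p (k + 1), jj s (p (k + 1)) := by
      rw [intervalIntegral.integral_const, hlen, Complex.real_smul]
      push_cast
      ring
    rw [e1, e2, ← intervalIntegral.integral_sub intervalIntegrable_const (hint k hk)]
    have := intervalIntegral.norm_integral_le_of_norm_le_const (a := p k) (b := p (k + 1))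
      (f := fun u => jj s (p (k + 1)) - jj s u) (C := C * (1 / (n + 1))) ?_
    · rwa [hlen, abs_of_nonneg (by positivity)] at this
    · intro u hu
      rw [Set.uIoc_of_le (hmono (Nat.le_succ k))] at hu
      have h1 := hin k hk.le
      have h2 := hin (k + 1) hk
      refine (jj_lip hs (abs_le.2 h2) (abs_le.2 ⟨h1.1.trans hu.1.le, hu.2.trans h2.2⟩)).trans ?_
      rw [← hC]
      gcongr
      rw [abs_of_nonneg (by linarith [hu.2]), ← hlen k]
      linarith [hu.1]
  refine (Finset.sum_le_sum hterm).trans (le_of_eq ?_)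
  rw [Finset.sum_const, Finset.card_range, nsmul_eq_mul]
  push_cast
  field_simp

noncomputable def XX (n m k : ℕ) : ℝ :=
  ((n : ℝ) + 1) * ((n : ℝ) + 1 + m) - ((k : ℝ) - n) ^ 2 / 4

noncomputable def ff (s : ℂ) (n m k : ℕ) : ℂ := (XX n m k : ℂ) ^ (-s)

noncomputable def ee (s : ℂ) (n m : ℕ) : ℂ :=
  ∑ k ∈ Finset.range (2 * (n + 1)),
    (ff s n m k - (gg s (XX n m k) - gg s (XX n (m + 1) k)) / ((n : ℝ) + 1 : ℝ))

noncomputable def bad (s : ℂ) (n : ℕ) : ℂ :=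
  ∑ k ∈ Finset.range (2 * (n + 1)), if k < n then ff s n 0 k else 0

noncomputable def psi (s : ℂ) (n : ℕ) : ℂ :=
  ∑ k ∈ Finset.range (2 * (n + 1)), gg s (XX n 0 k) / ((n : ℝ) + 1 : ℝ)

noncomputable def bb (s : ℂ) (n : ℕ) : ℂ :=
  (psi s n - 1 / ((n : ℂ) + 1) ^ (2 * s - 2) * (II s / (s - 1))) - bad s n

theorem XX_succ (n m k : ℕ) : XX n (m + 1) k = XX n m k + ((n : ℝ) + 1) := by
  simp only [XX]; push_cast; ring

theorem XX_lb {n k : ℕ} (m : ℕ) (hk : k < 2 * (n + 1)) :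
    3 / 4 * (((n : ℝ) + 1) * ((n : ℝ) + 1 + m)) ≤ XX n m k := by
  have h1 : (k : ℝ) ≤ 2 * n + 1 := by
    have : k ≤ 2 * n + 1 := by omega
    exact_mod_cast this
  have h0 : (0 : ℝ) ≤ k := by positivity
  have hm : (0 : ℝ) ≤ m := by positivity
  have hn : (0 : ℝ) ≤ n := by positivity
  have h2 : ((k : ℝ) - n) ^ 2 ≤ ((n : ℝ) + 1) ^ 2 := by
    apply sq_le_sq'
    · linarith
    · linarith
  simp only [XX]
  nlinarith [mul_nonneg hm hn]

theorem ac_one_le (n m : ℕ) : (1 : ℝ) ≤ ((n : ℝ) + 1) * ((n : ℝ) + 1 + m) := by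
  have hm : (0 : ℝ) ≤ m := by positivity
  have hn : (0 : ℝ) ≤ n := by positivity
  nlinarith [mul_nonneg hm hn]

theorem XX_pos {n k : ℕ} (m : ℕ) (hk : k < 2 * (n + 1)) : 0 < XX n m k := by
  linarith [XX_lb m hk, ac_one_le n m]

theorem XX_rpow {n k : ℕ} (m : ℕ) (hk : k < 2 * (n + 1)) {r r0 R : ℝ} (h0 : 0 ≤ r0) (hr : r0 ≤ r)
    (hR : r ≤ R) :
    XX n m k ^ (-r) ≤ (4 / 3 : ℝ) ^ R * (((n : ℝ) + 1) * ((n : ℝ) + 1 + m)) ^ (-r0) := by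
  have h1 := ac_one_le n m
  set q := ((n : ℝ) + 1) * ((n : ℝ) + 1 + m)
  calc XX n m k ^ (-r) ≤ (3 / 4 * q) ^ (-r) :=
        Real.rpow_le_rpow_of_nonpos (by linarith) (XX_lb m hk) (by linarith)
    _ = (3 / 4 : ℝ) ^ (-r) * q ^ (-r) := Real.mul_rpow (by norm_num) (by linarith)
    _ ≤ _ := by
      apply mul_le_mul (rpow_bound le_rfl (by linarith) hR)
        (Real.rpow_le_rpow_of_exponent_le h1 (by linarith)) (by positivity) (by positivity)

theorem ff_norm {s : ℂ} {n k : ℕ} (m : ℕ) (hk : k < 2 * (n + 1)) :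
    ‖ff s n m k‖ = XX n m k ^ (-s.re) := by
  rw [ff, Complex.norm_cpow_eq_rpow_re_of_pos (XX_pos m hk), Complex.neg_re]

noncomputable def uu (d : ℝ) (n m : ℕ) : ℝ := ((n : ℝ) + 1) ^ (-(1 + d)) * ((m : ℝ) + 1) ^ (-(1 + d))

theorem u1_summable {d : ℝ} (hd : 0 < d) : Summable fun n : ℕ => ((n : ℝ) + 1) ^ (-(1 + d)) := by
  have := (summable_nat_add_iff 1).2 (Real.summable_nat_rpow.2 (by linarith : -(1 + d) < -1))
  simpa using this

theorem uu_summable {d : ℝ} (hd : 0 < d) : Summable fun p : ℕ × ℕ => uu d p.1 p.2 :=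
  (u1_summable hd).mul_of_nonneg (u1_summable hd) (fun n => by positivity) (fun n => by positivity)

theorem pow_aux1 (n m : ℕ) {d : ℝ} (hd : 0 < d) :
    ((n : ℝ) + 1) ^ 2 * (((n : ℝ) + 1) * ((n : ℝ) + 1 + m)) ^ (-(2 + 2 * d)) ≤ uu d n m := by
  have ha : (0 : ℝ) < (n : ℝ) + 1 := by positivity
  have ha1 : (1 : ℝ) ≤ (n : ℝ) + 1 := by linarith [(by positivity : (0 : ℝ) ≤ n)]
  have hm : (0 : ℝ) ≤ m := by positivity
  set a := (n : ℝ) + 1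
  have hc : 0 < a + m := by linarith
  have hb : 0 < (m : ℝ) + 1 := by linarith
  have h1 : (a + m) ^ (-(1 + d)) ≤ a ^ (-(1 + d)) :=
    Real.rpow_le_rpow_of_nonpos ha (by linarith) (by linarith)
  have h2 : (a + m) ^ (-(1 + d)) ≤ ((m : ℝ) + 1) ^ (-(1 + d)) :=
    Real.rpow_le_rpow_of_nonpos hb (by linarith) (by linarith)
  have e : a ^ 2 * (a * (a + m)) ^ (-(2 + 2 * d))
      = a ^ (-(2 * d)) * ((a + m) ^ (-(1 + d)) * (a + m) ^ (-(1 + d))) := by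
    rw [Real.mul_rpow ha.le hc.le, ← mul_assoc, ← Real.rpow_natCast a 2, ← Real.rpow_add ha,
      ← Real.rpow_add hc]
    congr 2 <;> push_cast <;> ring
  have h3 : a ^ (-(2 * d)) ≤ 1 := Real.rpow_le_one_of_one_le_of_nonpos ha1 (by linarith)
  rw [e, uu]
  calc _ ≤ 1 * (a ^ (-(1 + d)) * ((m : ℝ) + 1) ^ (-(1 + d))) := by
        apply mul_le_mul h3 (mul_le_mul h1 h2 (by positivity) (by positivity)) (by positivity) zero_le_one
    _ = _ := one_mul _

theorem pow_aux2 (n m : ℕ) {d : ℝ} (hd : 0 < d) :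
    ((n : ℝ) + 1) * (((n : ℝ) + 1) * ((n : ℝ) + 1 + m)) ^ (-(3 / 2 + d)) ≤ uu d n m := by
  have ha : (0 : ℝ) < (n : ℝ) + 1 := by positivity
  have ha1 : (1 : ℝ) ≤ (n : ℝ) + 1 := by linarith [(by positivity : (0 : ℝ) ≤ n)]
  have hm : (0 : ℝ) ≤ m := by positivity
  set a := (n : ℝ) + 1
  have hc : 0 < a + m := by linarith
  have hb : 0 < (m : ℝ) + 1 := by linarith
  have h1 : (a + m) ^ (-(1 / 2 : ℝ)) ≤ a ^ (-(1 / 2 : ℝ)) :=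
    Real.rpow_le_rpow_of_nonpos ha (by linarith) (by linarith)
  have h2 : (a + m) ^ (-(1 + d)) ≤ ((m : ℝ) + 1) ^ (-(1 + d)) :=
    Real.rpow_le_rpow_of_nonpos hb (by linarith) (by linarith)
  have e : a * (a * (a + m)) ^ (-(3 / 2 + d))
      = a ^ (-(1 / 2 + d)) * ((a + m) ^ (-(1 / 2 : ℝ)) * (a + m) ^ (-(1 + d))) := by
    rw [Real.mul_rpow ha.le hc.le, ← mul_assoc]
    nth_rewrite 1 [← Real.rpow_one a]
    rw [← Real.rpow_add ha, ← Real.rpow_add hc]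
    congr 2 <;> ring
  rw [e, uu]
  calc _ ≤ a ^ (-(1 / 2 + d)) * (a ^ (-(1 / 2 : ℝ)) * ((m : ℝ) + 1) ^ (-(1 + d))) := by
        apply mul_le_mul_of_nonneg_left (mul_le_mul h1 h2 (by positivity) (by positivity)) (by positivity)
    _ = _ := by
        rw [← mul_assoc, ← Real.rpow_add ha]
        congr 2
        ring

theorem ee_bound {s : ℂ} {d R : ℝ} (hd : 0 < d) (hs : 1 + 2 * d ≤ s.re) (hR : ‖s‖ ≤ R) (n m : ℕ) :
    ‖ee s n m‖ ≤ 2 * R * (4 / 3 : ℝ) ^ (R + 1) * uu d n m := by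
  have hre := Complex.re_le_norm s
  have ha : (0 : ℝ) < (n : ℝ) + 1 := by positivity
  have hR0 : 0 ≤ R := (norm_nonneg s).trans hR
  have hterm : ∀ k ∈ Finset.range (2 * (n + 1)),
      ‖ff s n m k - (gg s (XX n m k) - gg s (XX n (m + 1) k)) / ((n : ℝ) + 1 : ℝ)‖ ≤
      R * ((4 / 3 : ℝ) ^ (R + 1) * (((n : ℝ) + 1) * ((n : ℝ) + 1 + m)) ^ (-(2 + 2 * d)))
        * ((n : ℝ) + 1) := by
    intro k hk
    have hk := Finset.mem_range.1 hk
    rw [XX_succ]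
    refine (gg_bound (by linarith) (XX_pos m hk) ha).trans ?_
    have h := XX_rpow m hk (r := s.re + 1) (r0 := 2 + 2 * d) (R := R + 1) (by linarith)
      (by linarith) (by linarith)
    rw [neg_add' s.re 1] at h
    have h0 := XX_pos m hk
    gcongr
  refine (norm_sum_le _ _).trans ((Finset.sum_le_sum hterm).trans ?_)
  rw [Finset.sum_const, Finset.card_range, nsmul_eq_mul]
  have h := mul_le_mul_of_nonneg_left (pow_aux1 n m hd)
    (by positivity : 0 ≤ 2 * R * (4 / 3 : ℝ) ^ (R + 1))
  refine le_trans (le_of_eq ?_) h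
  push_cast
  ring

theorem bad_bound {s : ℂ} {d R : ℝ} (hd : 0 < d) (hs : 1 + 2 * d ≤ s.re) (hR : ‖s‖ ≤ R) (n : ℕ) :
    ‖bad s n‖ ≤ 2 * (4 / 3 : ℝ) ^ R * ((n : ℝ) + 1) ^ (-(1 + d)) := by
  have hre := Complex.re_le_norm s
  have ha : (0 : ℝ) < (n : ℝ) + 1 := by positivity
  have ha1 : (1 : ℝ) ≤ (n : ℝ) + 1 := by linarith [(by positivity : (0 : ℝ) ≤ n)]
  have hterm : ∀ k ∈ Finset.range (2 * (n + 1)),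
      ‖if k < n then ff s n 0 k else 0‖ ≤
      (4 / 3 : ℝ) ^ R * ((n : ℝ) + 1) ^ (-(2 + d)) := by
    intro k hk
    have hk := Finset.mem_range.1 hk
    split_ifs
    · rw [ff_norm 0 hk]
      refine (XX_rpow 0 hk (r0 := 1 + d) (R := R) (by linarith) (by linarith) (by linarith)).trans ?_
      gcongr
      rw [Nat.cast_zero, add_zero, Real.mul_rpow ha.le ha.le, ← Real.rpow_add ha]
      exact Real.rpow_le_rpow_of_exponent_le ha1 (by linarith)
    · rw [norm_zero]; positivity
  refine (norm_sum_le _ _).trans ((Finset.sum_le_sum hterm).trans (le_of_eq ?_))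
  rw [Finset.sum_const, Finset.card_range, nsmul_eq_mul]
  have : ((n : ℝ) + 1) ^ (-(1 + d)) = ((n : ℝ) + 1) * ((n : ℝ) + 1) ^ (-(2 + d)) := by
    nth_rewrite 2 [← Real.rpow_one ((n : ℝ) + 1)]
    rw [← Real.rpow_add ha]
    congr 1
    ring
  rw [this]
  push_cast
  ring

theorem psi_eq (s : ℂ) (n : ℕ) :
    psi s n = 1 / ((n : ℂ) + 1) ^ (2 * s - 2) *
      (((∑ k ∈ Finset.range (2 * (n + 1)), jj s (((k : ℝ) - n) / (n + 1))) / (n + 1)) / (s - 1)) := by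
  have ha : (0 : ℝ) < (n : ℝ) + 1 := by positivity
  have hac : ((n : ℂ) + 1) ≠ 0 := by exact_mod_cast ha.ne'
  rw [psi, Finset.sum_div, Finset.sum_div, Finset.mul_sum]
  refine Finset.sum_congr rfl fun k hk => ?_
  have hk := Finset.mem_range.1 hk
  have hX := XX_pos 0 hk
  have e : XX n 0 k = ((n : ℝ) + 1) * (((n : ℝ) + 1) * (1 - (((k : ℝ) - n) / (n + 1)) ^ 2 / 4)) := by
    simp only [XX]; push_cast; field_simp; ring
  have hw : 0 ≤ 1 - (((k : ℝ) - n) / (n + 1)) ^ 2 / 4 := by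
    rw [e] at hX
    exact (pos_of_mul_pos_right (pos_of_mul_pos_right hX ha.le) ha.le).le
  rw [gg, e, Complex.ofReal_mul, Complex.mul_cpow_ofReal_nonneg ha.le (by positivity),
    Complex.ofReal_mul, Complex.mul_cpow_ofReal_nonneg ha.le hw, jj, ← mul_assoc, one_div,
    ← Complex.cpow_neg]
  have e2 : ((n : ℂ) + 1) ^ (-(2 * s - 2)) = (((n : ℝ) + 1 : ℝ) : ℂ) ^ (1 - s) * (((n : ℝ) + 1 : ℝ) : ℂ) ^ (1 - s) := by
    have : (((n : ℝ) + 1 : ℝ) : ℂ) = (n : ℂ) + 1 := by push_cast; rfl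
    rw [this, ← Complex.cpow_add _ _ hac]
    congr 1
    ring
  rw [e2]
  push_cast
  ring

theorem bb_bound {s : ℂ} {d R : ℝ} (hd : 0 < d) (hs : 1 + 2 * d ≤ s.re) (hR : ‖s‖ ≤ R) (n : ℕ) :
    ‖bb s n‖ ≤ (2 * ((R + 1) * (4 / 3 : ℝ) ^ R) / (2 * d) + 2 * (4 / 3 : ℝ) ^ R)
      * ((n : ℝ) + 1) ^ (-(1 + d)) := by
  have hre := Complex.re_le_norm s
  have ha : (0 : ℝ) < (n : ℝ) + 1 := by positivity
  have ha1 : (1 : ℝ) ≤ (n : ℝ) + 1 := by linarith [(by positivity : (0 : ℝ) ≤ n)]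
  have hR0 : 0 ≤ R := (norm_nonneg s).trans hR
  rw [bb, add_mul]
  refine (norm_sub_le _ _).trans (add_le_add ?_ (bad_bound hd hs hR n))
  rw [psi_eq, ← mul_sub, ← sub_div, norm_mul, norm_div _ (s - 1)]
  have h1 : ‖1 / ((n : ℂ) + 1) ^ (2 * s - 2)‖ ≤ ((n : ℝ) + 1) ^ (-d) := by
    have : (((n : ℝ) + 1 : ℝ) : ℂ) = (n : ℂ) + 1 := by push_cast; rfl
    rw [one_div, ← Complex.cpow_neg, ← this, Complex.norm_cpow_eq_rpow_re_of_pos ha]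
    apply Real.rpow_le_rpow_of_exponent_le ha1
    simp
    linarith
  have h2 : 2 * d ≤ ‖s - 1‖ := by
    have := Complex.re_le_norm (s - 1)
    simp at this
    linarith
  have h3 := riemann_bound (s := s) (by linarith) n
  have h4 : (4 / 3 : ℝ) ^ ‖s‖ ≤ (4 / 3 : ℝ) ^ R := Real.rpow_le_rpow_of_exponent_le (by norm_num) hR
  have h5 : 2 * ((‖s‖ + 1) * (4 / 3 : ℝ) ^ ‖s‖) / ((n : ℝ) + 1)
      ≤ 2 * ((R + 1) * (4 / 3 : ℝ) ^ R) / ((n : ℝ) + 1) := by gcongr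
  have h6 := div_le_div₀ (by positivity) (h3.trans h5) (by positivity) h2
  refine (mul_le_mul h1 h6 (by positivity) (by positivity)).trans (le_of_eq ?_)
  have : ((n : ℝ) + 1) ^ (-(1 + d)) = ((n : ℝ) + 1) ^ (-d) / ((n : ℝ) + 1) := by
    rw [← Real.rpow_sub_one ha.ne']
    congr 1
    ring
  rw [this]
  field_simp

theorem tsum_diff {ι : Type} {F : ι → ℂ → ℂ}
    (hF : ∀ i, DifferentiableOn ℂ (F i) {s | 1 < s.re})
    (hb : ∀ d R : ℝ, 0 < d → ∃ u : ι → ℝ, Summable u ∧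
      ∀ i s, 1 + 2 * d ≤ s.re → ‖s‖ ≤ R → ‖F i s‖ ≤ u i) :
    DifferentiableOn ℂ (fun s => ∑' i, F i s) {s | 1 < s.re} := by
  intro s hs
  simp only [Set.mem_ofPred_eq] at hs
  set d := (s.re - 1) / 4 with hd
  obtain ⟨u, hu, hbd⟩ := hb d (‖s‖ + 1) (by rw [hd]; linarith)
  have hop : IsOpen ({z : ℂ | 1 + 2 * d < z.re} ∩ {z | ‖z‖ < ‖s‖ + 1}) :=
    (isOpen_lt continuous_const Complex.continuous_re).inter
      (isOpen_lt continuous_norm continuous_const)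
  have key := Complex.differentiableOn_tsum_of_summable_norm
    (U := {z : ℂ | 1 + 2 * d < z.re} ∩ {z | ‖z‖ < ‖s‖ + 1}) hu
    (fun i => (hF i).mono (fun z hz => by
      have h1 : 1 + 2 * d < z.re := hz.1
      simp only [Set.mem_ofPred_eq]
      linarith)) hop (fun i z hz => hbd i z (le_of_lt hz.1) (le_of_lt hz.2))
  refine (key.differentiableAt (hop.mem_nhds ⟨?_, ?_⟩)).differentiableWithinAt
  · simp only [Set.mem_ofPred_eq]; linarith
  · simp

theorem ne_one_of_re {s : ℂ} (hs : 1 < s.re) : s - 1 ≠ 0 := by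
  intro h
  have := congrArg Complex.re h
  simp at this
  linarith

theorem ff_diff {n k : ℕ} (m : ℕ) (hk : k < 2 * (n + 1)) (s : ℂ) :
    DifferentiableAt ℂ (fun s => ff s n m k) s := by
  have h : (XX n m k : ℂ) ≠ 0 := by exact_mod_cast (XX_pos m hk).ne'
  exact DifferentiableAt.const_cpow (by fun_prop) (Or.inl h)

theorem gg_diff {x : ℝ} (hx : 0 < x) {s : ℂ} (hs : 1 < s.re) :
    DifferentiableAt ℂ (fun s => gg s x) s := by
  have h : (x : ℂ) ≠ 0 := by exact_mod_cast hx.ne'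
  unfold gg
  exact (DifferentiableAt.const_cpow (by fun_prop) (Or.inl h)).div (by fun_prop) (ne_one_of_re hs)

theorem ee_diff (n m : ℕ) : DifferentiableOn ℂ (fun s => ee s n m) {s | 1 < s.re} := by
  intro s hs
  apply DifferentiableAt.differentiableWithinAt
  unfold ee
  refine DifferentiableAt.fun_sum fun k hk => ?_
  have hk := Finset.mem_range.1 hk
  exact (ff_diff m hk s).sub
    (((gg_diff (XX_pos m hk) hs).sub (gg_diff (XX_pos (m + 1) hk) hs)).div_const _)

theorem bb_diff (n : ℕ) : DifferentiableOn ℂ (fun s => bb s n) {s | 1 < s.re} := by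
  intro s hs
  apply DifferentiableAt.differentiableWithinAt
  have hII : DifferentiableAt ℂ II s := (II_diff s trivial).differentiableAt univ_mem
  have hac : ((n : ℂ) + 1) ≠ 0 := by exact_mod_cast Nat.succ_ne_zero n
  unfold bb
  refine (DifferentiableAt.sub ?_ (DifferentiableAt.mul ?_ ?_)).sub ?_
  · unfold psi
    refine DifferentiableAt.fun_sum fun k hk => ?_
    have hk := Finset.mem_range.1 hk
    exact (gg_diff (XX_pos 0 hk) hs).div_const _
  · refine DifferentiableAt.div (differentiableAt_const _)
      (DifferentiableAt.const_cpow (by fun_prop) (Or.inl hac)) ?_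
    rw [Complex.cpow_ne_zero_iff]
    exact Or.inl hac
  · exact hII.div (by fun_prop) (ne_one_of_re hs)
  · unfold bad
    refine DifferentiableAt.fun_sum fun k hk => ?_
    have hk := Finset.mem_range.1 hk
    split_ifs
    · exact ff_diff 0 hk s
    · exact differentiableAt_const _

theorem A_diff : DifferentiableOn ℂ (fun s => ∑' p : ℕ × ℕ, ee s p.1 p.2) {s | 1 < s.re} :=
  tsum_diff (F := fun (p : ℕ × ℕ) s => ee s p.1 p.2) (fun p => ee_diff p.1 p.2) fun d R hd =>
    ⟨_, (uu_summable hd).mul_left (2 * R * (4 / 3 : ℝ) ^ (R + 1)),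
      fun p _ hs hR => ee_bound hd hs hR p.1 p.2⟩

theorem B_diff : DifferentiableOn ℂ (fun s => ∑' n : ℕ, bb s n) {s | 1 < s.re} :=
  tsum_diff (F := fun (n : ℕ) s => bb s n) bb_diff fun d R hd =>
    ⟨_, (u1_summable hd).mul_left
      (2 * ((R + 1) * (4 / 3 : ℝ) ^ R) / (2 * d) + 2 * (4 / 3 : ℝ) ^ R),
      fun n _ hs hR => bb_bound hd hs hR n⟩

theorem ee_summable {s : ℂ} (hs : 1 < s.re) : Summable fun p : ℕ × ℕ => ee s p.1 p.2 := by
  have hd : 0 < (s.re - 1) / 2 := by linarith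
  exact Summable.of_norm_bounded ((uu_summable hd).mul_left _)
    fun p => ee_bound hd (by linarith) le_rfl p.1 p.2

theorem bb_summable {s : ℂ} (hs : 1 < s.re) : Summable fun n : ℕ => bb s n := by
  have hd : 0 < (s.re - 1) / 2 := by linarith
  exact Summable.of_norm_bounded ((u1_summable hd).mul_left _)
    fun n => bb_bound hd (by linarith) le_rfl n

open Classical in
noncomputable def FF (s : ℂ) (p : (ℕ × ℕ) × ℕ) : ℂ :=
  if p.2 < 2 * (p.1.1 + 1) ∧ ¬ (p.1.2 = 0 ∧ p.2 < p.1.1) then ff s p.1.1 p.1.2 p.2 else 0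

noncomputable def hh (s : ℂ) (n m : ℕ) : ℂ := ∑ k ∈ Finset.range (2 * (n + 1)), FF s ((n, m), k)

theorem FF_zero {s : ℂ} {n m k : ℕ} (hk : k ∉ Finset.range (2 * (n + 1))) : FF s ((n, m), k) = 0 := by
  rw [Finset.mem_range] at hk
  simp [FF, hk]

theorem FF_norm_summable {s : ℂ} (hs : 3 / 2 < s.re) : Summable fun p => ‖FF s p‖ := by
  have hd : 0 < s.re - 3 / 2 := by linarith
  rw [summable_prod_of_nonneg (fun p => norm_nonneg _)]
  have hsup : ∀ p : ℕ × ℕ, ∀ k ∉ Finset.range (2 * (p.1 + 1)), ‖FF s (p, k)‖ = 0 := by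
    intro p k hk
    rw [norm_eq_zero]
    exact FF_zero hk
  refine ⟨fun p => summable_of_ne_finset_zero (s := Finset.range (2 * (p.1 + 1))) (hsup p), ?_⟩
  refine Summable.of_nonneg_of_le (fun p => tsum_nonneg fun k => norm_nonneg _) (fun p => ?_)
    ((uu_summable hd).mul_left (2 * (4 / 3 : ℝ) ^ s.re))
  rw [tsum_eq_sum (s := Finset.range (2 * (p.1 + 1))) (hsup p)]
  have hterm : ∀ k ∈ Finset.range (2 * (p.1 + 1)), ‖FF s (p, k)‖ ≤
      (4 / 3 : ℝ) ^ s.re * (((p.1 : ℝ) + 1) * ((p.1 : ℝ) + 1 + p.2)) ^ (-(3 / 2 + (s.re - 3 / 2))) := by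
    intro k hk
    have hk := Finset.mem_range.1 hk
    rw [FF]
    split_ifs
    · rw [ff_norm _ hk]
      exact XX_rpow _ hk (by linarith) (by linarith) le_rfl
    · rw [norm_zero]
      have := ac_one_le p.1 p.2
      positivity
  refine (Finset.sum_le_sum hterm).trans ?_
  rw [Finset.sum_const, Finset.card_range, nsmul_eq_mul]
  have h := mul_le_mul_of_nonneg_left (pow_aux2 p.1 p.2 hd)
    (by positivity : 0 ≤ 2 * (4 / 3 : ℝ) ^ s.re)
  refine le_trans (le_of_eq ?_) h
  push_cast
  ring

/-- The indexing map. -/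
def idx (T : ReducedMat) : (ℕ × ℕ) × ℕ :=
  (((T.a - 1).toNat, (T.c - T.a).toNat), (T.b2 + T.a - 1).toNat)

theorem RM_b2 (T : ReducedMat) : -T.a < T.b2 ∧ T.b2 ≤ T.a := by
  have h1 := abs_le.1 T.hred1
  have ha := T.ha
  refine ⟨lt_of_le_of_ne h1.1 fun h => ?_, h1.2⟩
  have := T.hred3 (Or.inl (by rw [← h, abs_neg, abs_of_pos ha]))
  omega

theorem idx_inj : Function.Injective idx := by
  intro S T h
  simp only [idx, Prod.mk.injEq] at h
  have hS := RM_b2 S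
  have hT := RM_b2 T
  have h1 := S.ha
  have h2 := T.ha
  have h3 := S.hred2
  have h4 := T.hred2
  obtain ⟨⟨e1, e2⟩, e3⟩ := h
  have ea : S.a = T.a := by omega
  have eb : S.b2 = T.b2 := by omega
  have ec : S.c = T.c := by omega
  cases S; cases T
  simp only at ea eb ec
  subst ea eb ec
  rfl

theorem FF_idx (s : ℂ) (T : ReducedMat) : FF s (idx T) = ((T.det : ℝ) : ℂ) ^ (-s) := by
  have hT := RM_b2 T
  have h2 := T.ha
  have h4 := T.hred2
  have h5 : T.a = T.c → 0 ≤ T.b2 := fun h => T.hred3 (Or.inr h)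
  rw [FF, if_pos]
  · rw [ff]
    congr 2
    simp only [idx, XX, ReducedMat.det]
    have c1 : (((T.a - 1).toNat : ℕ) : ℝ) = (T.a : ℝ) - 1 := by
      have : (((T.a - 1).toNat : ℕ) : ℤ) = T.a - 1 := Int.toNat_of_nonneg (by omega)
      exact_mod_cast congrArg (Int.cast : ℤ → ℝ) this
    have c2 : (((T.c - T.a).toNat : ℕ) : ℝ) = (T.c : ℝ) - T.a := by
      have : (((T.c - T.a).toNat : ℕ) : ℤ) = T.c - T.a := Int.toNat_of_nonneg (by omega)
      exact_mod_cast congrArg (Int.cast : ℤ → ℝ) this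
    have c3 : (((T.b2 + T.a - 1).toNat : ℕ) : ℝ) = (T.b2 : ℝ) + T.a - 1 := by
      have : (((T.b2 + T.a - 1).toNat : ℕ) : ℤ) = T.b2 + T.a - 1 := Int.toNat_of_nonneg (by omega)
      exact_mod_cast congrArg (Int.cast : ℤ → ℝ) this
    rw [c1, c2, c3]
    ring
  · simp only [idx]
    constructor
    · omega
    · rintro ⟨e1, e2⟩
      have := h5 (by omega)
      omega

theorem FF_support (s : ℂ) (p : (ℕ × ℕ) × ℕ) (hp : p ∉ Set.range idx) : FF s p = 0 := by
  rw [FF, if_neg]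
  rintro ⟨h1, h2⟩
  apply hp
  obtain ⟨⟨n, m⟩, k⟩ := p
  simp only at h1 h2
  have hab : |(k : ℤ) - n| ≤ (n : ℤ) + 1 := by rw [abs_le]; constructor <;> omega
  refine ⟨⟨(n : ℤ) + 1, (k : ℤ) - n, (n : ℤ) + 1 + m, by omega, ?_, hab, by omega, ?_⟩, ?_⟩
  · have h3 := sq_le_sq' (abs_le.1 hab).1 (abs_le.1 hab).2
    have hn : (0 : ℤ) ≤ n := by omega
    have hm : (0 : ℤ) ≤ m := by omega
    nlinarith [mul_nonneg hn hm]
  · rintro (h | h)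
    · rcases abs_cases ((k : ℤ) - n) with h' | h' <;> omega
    · omega
  · simp only [idx, Prod.mk.injEq]
    refine ⟨⟨?_, ?_⟩, ?_⟩ <;> omega

theorem RM_summable {s : ℂ} (hs : 3 / 2 < s.re) :
    Summable fun T : ReducedMat => ‖((T.det : ℝ) : ℂ) ^ (-s)‖ := by
  have := (FF_norm_summable hs).comp_injective idx_inj
  simpa only [Function.comp_def, FF_idx] using this

theorem RM_tsum {s : ℂ} (hs : 3 / 2 < s.re) :
    ∑' T : ReducedMat, ((T.det : ℝ) : ℂ) ^ (-s) = ∑' n : ℕ, ∑' m : ℕ, hh s n m ∧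
    Summable fun p : ℕ × ℕ => hh s p.1 p.2 := by
  have hF : Summable (FF s) := (FF_norm_summable hs).of_norm
  have hk : ∀ p : ℕ × ℕ, ∑' k, FF s (p, k) = hh s p.1 p.2 := fun p =>
    tsum_eq_sum fun k hk => FF_zero hk
  have h1 : Summable fun p : ℕ × ℕ => hh s p.1 p.2 := by
    simpa only [hk] using hF.prod
  refine ⟨?_, h1⟩
  have h2 : ∑' T : ReducedMat, ((T.det : ℝ) : ℂ) ^ (-s) = ∑' p, FF s p := by
    rw [← idx_inj.tsum_eq (f := FF s)]
    · simp only [FF_idx]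
    · intro p hp
      by_contra h
      exact hp (FF_support s p h)
  rw [h2, hF.tsum_prod]
  simp only [hk]
  exact h1.tsum_prod

theorem gg_tendsto {s : ℂ} (hs : 1 < s.re) : Tendsto (gg s) atTop (𝓝 0) := by
  rw [tendsto_zero_iff_norm_tendsto_zero]
  have h := (tendsto_rpow_neg_atTop (by linarith : 0 < s.re - 1)).div_const ‖s - 1‖
  rw [zero_div] at h
  refine h.congr' ?_
  filter_upwards [eventually_gt_atTop 0] with x hx
  rw [gg, norm_div, Complex.norm_cpow_eq_rpow_re_of_pos hx]
  simp

theorem XX_tendsto (n k : ℕ) : Tendsto (fun m => XX n m k) atTop atTop := by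
  unfold XX
  refine tendsto_atTop_add_const_right _ _ (Tendsto.const_mul_atTop (by positivity) ?_)
  exact tendsto_atTop_add_const_left _ _ tendsto_natCast_atTop_atTop

theorem hh_eq (s : ℂ) (n m : ℕ) : hh s n m = ee s n m +
    ((∑ k ∈ Finset.range (2 * (n + 1)), gg s (XX n m k) / ((n : ℝ) + 1 : ℝ)) -
     (∑ k ∈ Finset.range (2 * (n + 1)), gg s (XX n (m + 1) k) / ((n : ℝ) + 1 : ℝ))) -
    (if m = 0 then bad s n else 0) := by
  have e : (if m = 0 then bad s n else 0) =
      ∑ k ∈ Finset.range (2 * (n + 1)), if m = 0 ∧ k < n then ff s n m k else 0 := by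
    split_ifs with h
    · subst h
      simp [bad]
    · simp [h]
  rw [e, hh, ee, ← Finset.sum_sub_distrib, ← Finset.sum_add_distrib, ← Finset.sum_sub_distrib]
  refine Finset.sum_congr rfl fun k hk => ?_
  have hk := Finset.mem_range.1 hk
  rw [FF]
  simp only [hk, true_and]
  by_cases h : m = 0 ∧ k < n
  · simp only [h, not_true_eq_false, if_false, and_self, if_true]
    ring
  · simp only [h, not_false_eq_true, if_true, if_false]
    ring

theorem hh_tsum {s : ℂ} (hs : 1 < s.re) (n : ℕ) (hsum : Summable fun m => hh s n m) :
    ∑' m, hh s n m = (∑' m, ee s n m) + psi s n - bad s n := by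
  have he : Summable fun m => ee s n m := (ee_summable hs).prod_factor n
  set t : ℕ → ℂ := fun m => ∑ k ∈ Finset.range (2 * (n + 1)), gg s (XX n m k) / ((n : ℝ) + 1 : ℝ)
    with ht
  have hb : HasSum (fun m => if m = 0 then bad s n else 0) (bad s n) := hasSum_ite_eq 0 (bad s n)
  have heq : ∀ m, hh s n m = ee s n m + (t m - t (m + 1)) - (if m = 0 then bad s n else 0) :=
    fun m => hh_eq s n m
  have hts : Summable fun m => t m - t (m + 1) := by
    refine ((hsum.add hb.summable).sub he).congr fun m => ?_
    rw [heq]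
    ring
  have hlim : Tendsto t atTop (𝓝 0) := by
    rw [show (0 : ℂ) = ∑ k ∈ Finset.range (2 * (n + 1)), 0 / (((n : ℝ) + 1 : ℝ) : ℂ) by simp]
    exact tendsto_finsetSum _ fun k _ => ((gg_tendsto hs).comp (XX_tendsto n k)).div_const _
  have htel : HasSum (fun m => t m - t (m + 1)) (t 0) := by
    rw [hts.hasSum_iff_tendsto_nat]
    simp only [Finset.sum_range_sub']
    simpa using hlim.const_sub (t 0)
  have := ((he.hasSum.add htel).sub hb).tsum_eq
  rw [← tsum_congr heq] at this
  exact this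

theorem main_id {s : ℂ} (hs : 3 / 2 < s.re) :
    ∑' T : ReducedMat, ((T.det : ℝ) : ℂ) ^ (-s) =
      (∑' p : ℕ × ℕ, ee s p.1 p.2) + (∑' n, bb s n)
        + riemannZeta (2 * s - 2) * (II s / (s - 1)) := by
  have hs1 : 1 < s.re := by linarith
  obtain ⟨h1, h2⟩ := RM_tsum hs
  have hz : 1 < (2 * s - 2).re := by simp; linarith
  have hzs : Summable fun n : ℕ => 1 / ((n : ℂ) + 1) ^ (2 * s - 2) := by
    have := (summable_nat_add_iff 1).2 (Complex.summable_one_div_nat_cpow.2 hz)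
    simpa using this
  have he := ee_summable hs1
  rw [h1, zeta_eq_tsum_one_div_nat_add_one_cpow hz, ← tsum_mul_right, he.tsum_prod, add_assoc,
    ← (bb_summable hs1).tsum_add (hzs.mul_right _), ← he.prod.tsum_add]
  · refine tsum_congr fun n => ?_
    rw [hh_tsum hs1 n (h2.prod_factor n), bb]
    ring
  · exact (bb_summable hs1).add (hzs.mul_right _)

noncomputable def ZZ : ℂ → ℂ :=
  Function.update (fun s => riemannZeta s - 1 / (s - 1)) 1 Real.eulerMascheroniConstant

theorem ZZ_diff : Differentiable ℂ ZZ := by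
  rw [← differentiableOn_univ]
  rw [← Complex.differentiableOn_compl_singleton_and_continuousAt_iff (c := 1) univ_mem]
  constructor
  · intro s hs
    have hs1 : s ≠ 1 := hs.2
    have h : DifferentiableAt ℂ (fun s => riemannZeta s - 1 / (s - 1)) s :=
      (differentiableAt_riemannZeta hs1).sub
        ((differentiableAt_const _).div (by fun_prop) (sub_ne_zero.2 hs1))
    refine (h.congr_of_eventuallyEq ?_).differentiableWithinAt
    filter_upwards [isOpen_ne.mem_nhds hs1] with z hz
    exact Function.update_of_ne hz _ _
  · rw [ZZ, continuousAt_update_same]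
    exact tendsto_riemannZeta_sub_one_div

noncomputable def KK (v : ℂ) : ℂ := II (3 / 2 + 2 * v) / ((3 / 2 + 2 * v) - 1)

noncomputable def HH (v : ℂ) : ℂ :=
  (∑' p : ℕ × ℕ, ee (3 / 2 + 2 * v) p.1 p.2) + (∑' n, bb (3 / 2 + 2 * v) n)
    + (ZZ (1 + 4 * v) * KK v + dslope KK 0 v / 4)

theorem HH_diff : DifferentiableOn ℂ HH {v : ℂ | -1 / 4 < v.re} := by
  have hmaps : Set.MapsTo (fun v : ℂ => 3 / 2 + 2 * v) {v : ℂ | -1 / 4 < v.re} {s | 1 < s.re} := by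
    intro v hv
    simp only [Set.mem_ofPred_eq] at hv ⊢
    have : (3 / 2 + 2 * v).re = 3 / 2 + 2 * v.re := by simp
    linarith
  have hlin : DifferentiableOn ℂ (fun v : ℂ => 3 / 2 + 2 * v) {v : ℂ | -1 / 4 < v.re} := by fun_prop
  have hopen : IsOpen {v : ℂ | -1 / 4 < v.re} := isOpen_lt continuous_const Complex.continuous_re
  have hK : DifferentiableOn ℂ KK {v : ℂ | -1 / 4 < v.re} := by
    refine DifferentiableOn.div (II_diff.comp hlin fun _ _ => trivial) (by fun_prop) ?_
    intro v hv
    exact ne_one_of_re (hmaps hv)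
  refine ((A_diff.comp hlin hmaps).add (B_diff.comp hlin hmaps)).add (DifferentiableOn.add ?_ ?_)
  · refine DifferentiableOn.mul ?_ hK
    exact ZZ_diff.differentiableOn.comp (t := Set.univ) (by fun_prop) fun _ _ => trivial
  · refine DifferentiableOn.div_const ?_ _
    exact (Complex.differentiableOn_dslope (hopen.mem_nhds (by simp; norm_num))).2 hK

theorem KK_zero : KK 0 = 4 * Real.pi / 3 := by
  rw [KK, mul_zero, add_zero, II_val]
  push_cast
  norm_num
  ring

/-- the series `L(v) = Σ_T (det T)^{-(3/2+2v)}` converges absolutely for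
`Re v > 0`, and extends meromorphically to `Re v > -1/4` with a single simple pole at
`v = 0` of residue `π/3`. -/
theorem stmt_10 :
    (∀ v : ℂ, 0 < v.re →
      Summable (fun T : ReducedMat => ‖((T.det : ℝ) : ℂ) ^ (-(3/2 + 2*v))‖)) ∧
    ∃ H : ℂ → ℂ, DifferentiableOn ℂ H {v : ℂ | -1/4 < v.re} ∧
      ∀ v : ℂ, 0 < v.re →
        (∑' T : ReducedMat, ((T.det : ℝ) : ℂ) ^ (-(3/2 + 2*v)))
          = (Real.pi : ℂ) / (3 * v) + H v := by
  have hre : ∀ v : ℂ, 0 < v.re → 3 / 2 < (3 / 2 + 2 * v).re := by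
    intro v hv
    have : (3 / 2 + 2 * v).re = 3 / 2 + 2 * v.re := by simp
    linarith
  refine ⟨fun v hv => RM_summable (hre v hv), HH, HH_diff, fun v hv => ?_⟩
  have hv0 : v ≠ 0 := by
    rintro rfl
    simp at hv
  have h4 : 1 + 4 * v ≠ 1 := by simpa using hv0
  rw [main_id (hre v hv), HH, dslope_of_ne _ hv0, slope_def_field, KK_zero, ZZ,
    Function.update_of_ne h4, show 2 * (3 / 2 + 2 * v) - 2 = 1 + 4 * v by ring]
  change _ + _ * KK v = _
  field_simp
  ring
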